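/- Let $k$ be a commutative ring and let $(A,\Delta,\varepsilon,\Phi)$ be a quasi-bialgebra over $k$: $A$ is an associative unital $k$-algebra, $\Delta:A\to A\otimes_k A$ and $\varepsilon:A\to k$ are unital $k$-algebra homomorphisms, and $\Phi\in A\otimes_k A\otimes_k A$ is invertible, such that $$(\mathrm{id}\otimes\Delta)(\Delta(a))=\Phi\cdot(\Delta\otimes\mathrm{id})(\Delta(a))\cdot\Phi^{-1}\quad(a\in A),$$ $$(\mathrm{id}\otimes\mathrm{id}\otimes\Delta)(\Phi)\cdot(\Delta\otimes\mathrm{id}\otimes\mathrm{id})(\Phi)=(1\otimes\Phi)\cdot(\mathrm{id}\otimes\Delta\otimes\mathrm{id})(\Phi)\cdot(\Phi\otimes 1),$$ $(\varepsilon\otimes\mathrm{id})\circ\Delta=\mathrm{id}=(\mathrm{id}\otimes\varepsilon)\circ\Delta$ and $(\mathrm{id}\otimes\varepsilon\otimes\mathrm{id})(\Phi)=1$. Write $\Delta(a)=\sum a_1\otimes a_2$, $\Phi=\sum_i X_i\otimes Y_i\otimes Z_i$ and $\Phi^{-1}=\sum_j P_j\otimes Q_j\otimes R_j$. Let $(S,\alpha,\beta)$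 make $A$ a quasi-Hopf algebra: $S:A\to A$ is a $k$-linear map with $S(xy)=S(y)S(x)$ and $S(1)=1$ (not assumed bijective), and $\alpha,\beta\in A$ satisfy $$\sum S(a_1)\,\alpha\,a_2=\varepsilon(a)\,\alpha,\qquad \sum a_1\,\beta\,S(a_2)=\varepsilon(a)\,\beta\quad(a\in A),$$ $$\sum_i X_i\,\beta\,S(Y_i)\,\alpha\,Z_i=1,\qquad \sum_j S(P_j)\,\alpha\,Q_j\,\beta\,S(R_j)=1.$$ Let $\omega=\sum_j S(P_j)\,\alpha\,Q_j\otimes R_j\in A\otimes_k A$ (the image of $\Phi^{-1}$ under the $k$-linear map induced by $x\otimes y\otimes z\mapsto (S(x)\,\alpha\,y)\otimes z$). Define $k$-linear maps $\phi,\psi:A\otimes_k A\to A\otimes_k A$ by $$\phi(a\otimes b)=(a\otimes 1)\cdot\omega\cdot\Delta(b),\qquad \psi(a\otimes b)=\sum_i \bigl(a\,X_i\,\beta\,S(Y_i)\,S(b_1)\bigr)\otimes (b_2\,Z_i).$$ Then $\phi\circ\psi=\mathrm{id}$ and $\psi\circ\phi=\mathrm{id}$; in particular $\phi$ and $\psi$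 are mutually inverse bijections. -/

import Mathlib

open TensorProduct

/-- A quasi-bialgebra structure on the unital associative `k`-algebra `A`, in Drinfeld's convention
for the coassociator `Φ`. Triple and fourfold tensor powers are bracketed to the right. -/
structure QuasiBialgebra (k A : Type*) [CommRing k] [Ring A] [Algebra k A] where
  /-- the coproduct `Δ` -/
  comul : A →ₐ[k] A ⊗[k] A
  /-- the counit `ε` -/
  counit : A →ₐ[k] k
  /-- the coassociator, an invertible element of `A ⊗ A ⊗ A` -/
  Φ : (A ⊗[k] (A ⊗[k] A))ˣ
  /-- `(id ⊗ Δ)(Δ a) = Φ · (Δ ⊗ id)(Δ a) · Φ⁻¹` -/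
  quasi_coassoc : ∀ a : A,
    Algebra.TensorProduct.map (AlgHom.id k A) comul (comul a) =
      (Φ : A ⊗[k] (A ⊗[k] A)) *
        Algebra.TensorProduct.assoc k k k A A A
          (Algebra.TensorProduct.map comul (AlgHom.id k A) (comul a)) *
        (↑Φ⁻¹ : A ⊗[k] (A ⊗[k] A))
  /-- `(id ⊗ id ⊗ Δ)(Φ) · (Δ ⊗ id ⊗ id)(Φ) = (1 ⊗ Φ) · (id ⊗ Δ ⊗ id)(Φ) · (Φ ⊗ 1)` -/
  pentagon :
    Algebra.TensorProduct.map (AlgHom.id k A)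
        (Algebra.TensorProduct.map (AlgHom.id k A) comul) (Φ : A ⊗[k] (A ⊗[k] A)) *
      Algebra.TensorProduct.assoc k k k A A (A ⊗[k] A)
        (Algebra.TensorProduct.map comul (AlgHom.id k (A ⊗[k] A)) (Φ : A ⊗[k] (A ⊗[k] A))) =
    ((1 : A) ⊗ₜ[k] (Φ : A ⊗[k] (A ⊗[k] A))) *
      Algebra.TensorProduct.map (AlgHom.id k A)
        ((Algebra.TensorProduct.assoc k k k A A A).toAlgHom.comp
          (Algebra.TensorProduct.map comul (AlgHom.id k A))) (Φ : A ⊗[k] (A ⊗[k] A)) *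
      Algebra.TensorProduct.map (AlgHom.id k A)
        (Algebra.TensorProduct.map (AlgHom.id k A)
          (Algebra.TensorProduct.includeLeft : A →ₐ[k] A ⊗[k] A)) (Φ : A ⊗[k] (A ⊗[k] A))
  /-- `(ε ⊗ id) ∘ Δ = id` -/
  counit_left : ∀ a : A,
    Algebra.TensorProduct.lid k A
      (Algebra.TensorProduct.map counit (AlgHom.id k A) (comul a)) = a
  /-- `(id ⊗ ε) ∘ Δ = id` -/
  counit_right : ∀ a : A,
    Algebra.TensorProduct.rid k k A
      (Algebra.TensorProduct.map (AlgHom.id k A) counit (comul a)) = a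
  /-- `(id ⊗ ε ⊗ id)(Φ) = 1` -/
  counit_middle :
    Algebra.TensorProduct.map (AlgHom.id k A)
      ((Algebra.TensorProduct.lid k A).toAlgHom.comp
        (Algebra.TensorProduct.map counit (AlgHom.id k A))) (Φ : A ⊗[k] (A ⊗[k] A)) = 1

namespace QuasiHopf

variable {k A : Type*} [CommRing k] [Ring A] [Algebra k A]

/-- The linear map `x ⊗ y ↦ S(x) · α · y`. -/
noncomputable def evMap (S : A →ₗ[k] A) (α : A) : A ⊗[k] A →ₗ[k] A :=
  LinearMap.mul' k A ∘ₗ TensorProduct.map (LinearMap.mulRight k α ∘ₗ S) LinearMap.id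

/-- The linear map `x ⊗ y ↦ x · β · S(y)`. -/
noncomputable def coevMap (S : A →ₗ[k] A) (β : A) : A ⊗[k] A →ₗ[k] A :=
  LinearMap.mul' k A ∘ₗ TensorProduct.map (LinearMap.mulRight k β) S

/-- The linear map `x ⊗ y ⊗ z ↦ x · β · S(y) · α · z`. -/
noncomputable def zigMap (S : A →ₗ[k] A) (α β : A) : A ⊗[k] (A ⊗[k] A) →ₗ[k] A :=
  LinearMap.mul' k A ∘ₗ TensorProduct.map (LinearMap.mulRight k β) (evMap S α)

/-- The linear map `x ⊗ y ⊗ z ↦ S(x) · α · y · β · S(z)`. -/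
noncomputable def zagMap (S : A →ₗ[k] A) (α β : A) : A ⊗[k] (A ⊗[k] A) →ₗ[k] A :=
  LinearMap.mul' k A ∘ₗ TensorProduct.map (LinearMap.mulRight k α ∘ₗ S) (coevMap S β)

@[simp] theorem evMap_tmul (S : A →ₗ[k] A) (α x y : A) :
    evMap S α (x ⊗ₜ[k] y) = S x * α * y := by
  simp [evMap]

@[simp] theorem coevMap_tmul (S : A →ₗ[k] A) (β x y : A) :
    coevMap S β (x ⊗ₜ[k] y) = x * β * S y := by
  simp [coevMap]

@[simp] theorem zigMap_tmul (S : A →ₗ[k] A) (α β x y z : A) :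
    zigMap S α β (x ⊗ₜ[k] (y ⊗ₜ[k] z)) = x * β * S y * α * z := by
  simp [zigMap, mul_assoc]

@[simp] theorem zagMap_tmul (S : A →ₗ[k] A) (α β x y z : A) :
    zagMap S α β (x ⊗ₜ[k] (y ⊗ₜ[k] z)) = S x * α * y * β * S z := by
  simp [zagMap, mul_assoc]

end QuasiHopf

/-- A quasi-Hopf algebra structure `(Δ, ε, Φ, S, α, β)` on `A`; the antipode `S` is not assumed
to be bijective. -/
structure QuasiHopfAlgebra (k A : Type*) [CommRing k] [Ring A] [Algebra k A] extends
    QuasiBialgebra k A where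
  /-- the antipode -/
  S : A →ₗ[k] A
  S_mul : ∀ x y : A, S (x * y) = S y * S x
  S_one : S 1 = 1
  α : A
  β : A
  /-- `Σ S(a₁) · α · a₂ = ε(a) · α` -/
  antipode_left : ∀ a : A, QuasiHopf.evMap S α (comul a) = counit a • α
  /-- `Σ a₁ · β · S(a₂) = ε(a) · β` -/
  antipode_right : ∀ a : A, QuasiHopf.coevMap S β (comul a) = counit a • β
  /-- `Σ Xᵢ · β · S(Yᵢ) · α · Zᵢ = 1` for `Φ = Σ Xᵢ ⊗ Yᵢ ⊗ Zᵢ` -/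
  zig : QuasiHopf.zigMap S α β (Φ : A ⊗[k] (A ⊗[k] A)) = 1
  /-- `Σ S(Pⱼ) · α · Qⱼ · β · S(Rⱼ) = 1` for `Φ⁻¹ = Σ Pⱼ ⊗ Qⱼ ⊗ Rⱼ` -/
  zag : QuasiHopf.zagMap S α β (↑Φ⁻¹ : A ⊗[k] (A ⊗[k] A)) = 1

namespace QuasiHopfAlgebra

variable {k A : Type*} [CommRing k] [Ring A] [Algebra k A] (Q : QuasiHopfAlgebra k A)

/-- `ω = Σ S(Pⱼ) · α · Qⱼ ⊗ Rⱼ`, the image of `Φ⁻¹` under `x ⊗ y ⊗ z ↦ (S(x) · α · y) ⊗ z`. -/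
noncomputable def omega : A ⊗[k] A :=
  TensorProduct.map (QuasiHopf.evMap Q.S Q.α) LinearMap.id
    ((TensorProduct.assoc k A A A).symm (↑Q.Φ⁻¹ : A ⊗[k] (A ⊗[k] A)))

/-- `φ(a ⊗ b) = (a ⊗ 1) · ω · Δ(b)`. -/
noncomputable def phi : A ⊗[k] A →ₗ[k] A ⊗[k] A :=
  TensorProduct.lift ((LinearMap.mul k (A ⊗[k] A)).compl₁₂
    (LinearMap.mulRight k Q.omega ∘ₗ
      (Algebra.TensorProduct.includeLeft : A →ₐ[k] A ⊗[k] A).toLinearMap)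
    Q.comul.toLinearMap)

/-- `Σ Xᵢ · β · S(Yᵢ) ⊗ Zᵢ`, the image of `Φ` under `x ⊗ y ⊗ z ↦ (x · β · S(y)) ⊗ z`. -/
noncomputable def theta : A ⊗[k] A :=
  TensorProduct.map (QuasiHopf.coevMap Q.S Q.β) LinearMap.id
    ((TensorProduct.assoc k A A A).symm (Q.Φ : A ⊗[k] (A ⊗[k] A)))

/-- The bilinear map `(p ⊗ z, u ⊗ v) ↦ (p · S(u)) ⊗ (v · z)`. -/
noncomputable def sandwich : A ⊗[k] A →ₗ[k] A ⊗[k] A →ₗ[k] A ⊗[k] A :=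
  TensorProduct.map₂ ((LinearMap.mul k A).compl₂ Q.S) (LinearMap.mul k A).flip

/-- `ψ(a ⊗ b) = Σ (a · Xᵢ · β · S(Yᵢ) · S(b₁)) ⊗ (b₂ · Zᵢ)`; see `psi_tmul`. -/
noncomputable def psi : A ⊗[k] A →ₗ[k] A ⊗[k] A :=
  TensorProduct.lift ((LinearMap.mul k (A ⊗[k] A)).compl₁₂
    (Algebra.TensorProduct.includeLeft : A →ₐ[k] A ⊗[k] A).toLinearMap
    (Q.sandwich Q.theta ∘ₗ Q.comul.toLinearMap))

theorem omega_eq {ι : Type*} (s : Finset ι) (P U R : ι → A)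
    (h : (↑Q.Φ⁻¹ : A ⊗[k] (A ⊗[k] A)) = ∑ j ∈ s, P j ⊗ₜ[k] (U j ⊗ₜ[k] R j)) :
    Q.omega = ∑ j ∈ s, (Q.S (P j) * Q.α * U j) ⊗ₜ[k] R j := by
  simp [omega, h]

theorem phi_tmul (a b : A) :
    Q.phi (a ⊗ₜ[k] b) = (a ⊗ₜ[k] (1 : A)) * Q.omega * Q.comul b := by
  simp [phi]

theorem psi_tmul {ι κ : Type*} (s : Finset ι) (X Y Z : ι → A)
    (hΦ : (Q.Φ : A ⊗[k] (A ⊗[k] A)) = ∑ i ∈ s, X i ⊗ₜ[k] (Y i ⊗ₜ[k] Z i))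
    (a b : A) (t : Finset κ) (b₁ b₂ : κ → A) (hb : Q.comul b = ∑ j ∈ t, b₁ j ⊗ₜ[k] b₂ j) :
    Q.psi (a ⊗ₜ[k] b) = ∑ i ∈ s, ∑ j ∈ t,
      (a * X i * Q.β * Q.S (Y i) * Q.S (b₁ j)) ⊗ₜ[k] (b₂ j * Z i) := by
  simp [psi, theta, sandwich, hΦ, hb, mul_assoc]

end QuasiHopfAlgebra

set_option maxSynthPendingDepth 6

namespace TensorProduct

variable {k A : Type*} [CommRing k] [Ring A] [Algebra k A]

/-- Induction on elements of a threefold tensor power. -/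
theorem threefold_induction {P : A ⊗[k] (A ⊗[k] A) → Prop}
    (tmul : ∀ x y z : A, P (x ⊗ₜ[k] (y ⊗ₜ[k] z))) (add : ∀ u v, P u → P v → P (u + v))
    (w : A ⊗[k] (A ⊗[k] A)) : P w := by
  induction w with
  | zero => simpa using tmul 0 0 0
  | add u v hu hv => exact add u v hu hv
  | tmul x w =>
    induction w with
    | zero => simpa using tmul 0 0 0
    | add u v hu hv => rw [tmul_add]; exact add _ _ hu hv
    | tmul y z => exact tmul x y z

/-- Induction on elements of a fourfold tensor power. -/
theorem fourfold_induction {P : A ⊗[k] (A ⊗[k] (A ⊗[k] A)) → Prop}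
    (tmul : ∀ x y z t : A, P (x ⊗ₜ[k] (y ⊗ₜ[k] (z ⊗ₜ[k] t))))
    (add : ∀ u v, P u → P v → P (u + v)) (w : A ⊗[k] (A ⊗[k] (A ⊗[k] A))) : P w := by
  induction w with
  | zero => simpa using tmul 0 0 0 0
  | add u v hu hv => exact add u v hu hv
  | tmul x w =>
    induction w using threefold_induction with
    | add u v hu hv => rw [tmul_add]; exact add _ _ hu hv
    | tmul y z t => exact tmul x y z t

end TensorProduct

namespace QuasiBialgebra

variable {k A : Type*} [CommRing k] [Ring A] [Algebra k A] (Q : QuasiBialgebra k A)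

/-- The algebra map `ε ⊗ id : A ⊗ B → B`. -/
noncomputable def counitLeft (B : Type*) [Ring B] [Algebra k B] : A ⊗[k] B →ₐ[k] B :=
  (Algebra.TensorProduct.lid k B).toAlgHom.comp
    (Algebra.TensorProduct.map Q.counit (AlgHom.id k B))

@[simp] theorem counitLeft_tmul {B : Type*} [Ring B] [Algebra k B] (a : A) (b : B) :
    Q.counitLeft B (a ⊗ₜ[k] b) = Q.counit a • b := by
  simp [counitLeft]

/-- The algebra map `Δ ⊗ id : A ⊗ B → A ⊗ A ⊗ B`, bracketed to the right. -/
noncomputable def comulLeft (B : Type*) [Ring B] [Algebra k B] :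
    A ⊗[k] B →ₐ[k] A ⊗[k] (A ⊗[k] B) :=
  (Algebra.TensorProduct.assoc k k k A A B).toAlgHom.comp
    (Algebra.TensorProduct.map Q.comul (AlgHom.id k B))

theorem comulLeft_tmul {B : Type*} [Ring B] [Algebra k B] (a : A) (b : B) :
    Q.comulLeft B (a ⊗ₜ[k] b) = Algebra.TensorProduct.assoc k k k A A B (Q.comul a ⊗ₜ[k] b) := by
  simp [comulLeft]

/-- The algebra map `id ⊗ Δ : B ⊗ A → B ⊗ A ⊗ A`. -/
noncomputable def comulRight (B : Type*) [Ring B] [Algebra k B] :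
    B ⊗[k] A →ₐ[k] B ⊗[k] (A ⊗[k] A) :=
  Algebra.TensorProduct.map (AlgHom.id k B) Q.comul

@[simp] theorem comulRight_tmul {B : Type*} [Ring B] [Algebra k B] (b : B) (a : A) :
    Q.comulRight B (b ⊗ₜ[k] a) = b ⊗ₜ[k] Q.comul a := by
  simp [comulRight]

theorem counitLeft_comul (a : A) : Q.counitLeft A (Q.comul a) = a := Q.counit_left a

theorem map_counitLeft_Φ :
    Algebra.TensorProduct.map (AlgHom.id k A) (Q.counitLeft A) Q.Φ = 1 :=
  Q.counit_middle

theorem comulRight_comul_mul_Φ (a : A) :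
    Q.comulRight A (Q.comul a) * Q.Φ =
      Q.Φ * Q.comulLeft A (Q.comul a) := by
  have h := Q.quasi_coassoc a
  change Q.comulRight A (Q.comul a) = _ * Q.comulLeft A (Q.comul a) * _ at h
  rw [h, mul_assoc, Units.inv_mul, mul_one]

theorem Φ_inv_mul_comulRight_comul (a : A) :
    ↑Q.Φ⁻¹ * Q.comulRight A (Q.comul a) =
      Q.comulLeft A (Q.comul a) * ↑Q.Φ⁻¹ := by
  rw [Units.inv_mul_eq_iff_eq_mul, ← mul_assoc, ← comulRight_comul_mul_Φ, mul_assoc,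
    Units.mul_inv, mul_one]

/-- `id ⊗ id ⊗ Δ` on the threefold tensor power. -/
noncomputable def comulThird : A ⊗[k] (A ⊗[k] A) →ₐ[k] A ⊗[k] (A ⊗[k] (A ⊗[k] A)) :=
  Algebra.TensorProduct.map (AlgHom.id k A) (Q.comulRight A)

/-- `id ⊗ Δ ⊗ id` on the threefold tensor power. -/
noncomputable def comulSecond : A ⊗[k] (A ⊗[k] A) →ₐ[k] A ⊗[k] (A ⊗[k] (A ⊗[k] A)) :=
  Algebra.TensorProduct.map (AlgHom.id k A) (Q.comulLeft A)

variable (k A) in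
/-- `w ↦ w ⊗ 1` from the threefold to the fourfold tensor power. -/
noncomputable def appendOne : A ⊗[k] (A ⊗[k] A) →ₐ[k] A ⊗[k] (A ⊗[k] (A ⊗[k] A)) :=
  Algebra.TensorProduct.map (AlgHom.id k A) (Algebra.TensorProduct.map (AlgHom.id k A)
    (Algebra.TensorProduct.includeLeft : A →ₐ[k] A ⊗[k] A))

variable (k A) in
/-- `w ↦ 1 ⊗ w` from the threefold to the fourfold tensor power. -/
noncomputable def prependOne : A ⊗[k] (A ⊗[k] A) →ₐ[k] A ⊗[k] (A ⊗[k] (A ⊗[k] A)) :=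
  Algebra.TensorProduct.includeRight

@[simp] theorem comulThird_tmul (x : A) (w : A ⊗[k] A) :
    Q.comulThird (x ⊗ₜ[k] w) = x ⊗ₜ[k] Q.comulRight A w := by
  simp [comulThird]

theorem comulSecond_tmul (x : A) (w : A ⊗[k] A) :
    Q.comulSecond (x ⊗ₜ[k] w) = x ⊗ₜ[k] Q.comulLeft A w := by
  simp [comulSecond]

@[simp] theorem appendOne_tmul (x y z : A) :
    appendOne k A (x ⊗ₜ[k] (y ⊗ₜ[k] z)) = x ⊗ₜ[k] (y ⊗ₜ[k] (z ⊗ₜ[k] 1)) := by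
  simp [appendOne]

@[simp] theorem prependOne_apply (w : A ⊗[k] (A ⊗[k] A)) :
    prependOne k A w = 1 ⊗ₜ[k] w := rfl

theorem pentagon' :
    Q.comulThird Q.Φ * Q.comulLeft (A ⊗[k] A) Q.Φ =
      prependOne k A Q.Φ * Q.comulSecond Q.Φ * appendOne k A Q.Φ :=
  Q.pentagon

theorem map_counitLeft_comulThird (w : A ⊗[k] (A ⊗[k] A)) :
    Algebra.TensorProduct.map (AlgHom.id k A) (Q.counitLeft (A ⊗[k] A)) (Q.comulThird w) =
      Q.comulRight A (Algebra.TensorProduct.map (AlgHom.id k A) (Q.counitLeft A) w) := by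
  induction w using threefold_induction with
  | add x y hx hy => simp only [map_add, hx, hy]
  | tmul x y z => simp

theorem map_counitLeft_comulLeft {B : Type*} [Ring B] [Algebra k B] (w : A ⊗[k] B) :
    Algebra.TensorProduct.map (AlgHom.id k A) (Q.counitLeft B) (Q.comulLeft B w) = w := by
  induction w with
  | zero => simp
  | add x y hx hy => simp only [map_add, hx, hy]
  | tmul x b =>
    conv_rhs => rw [← Q.counit_right x]
    rw [comulLeft_tmul]
    generalize Q.comul x = t
    induction t with
    | zero => simp
    | add x y hx hy => simp only [map_add, add_tmul, hx, hy]
    | tmul y z => simp [smul_tmul]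

theorem counitLeft_comulLeft {B : Type*} [Ring B] [Algebra k B] (w : A ⊗[k] B) :
    Q.counitLeft (A ⊗[k] B) (Q.comulLeft B w) = w := by
  induction w with
  | zero => simp
  | add x y hx hy => simp only [map_add, hx, hy]
  | tmul x b =>
    conv_rhs => rw [← Q.counit_left x]
    rw [comulLeft_tmul]
    generalize Q.comul x = t
    induction t with
    | zero => simp
    | add x y hx hy => simp only [map_add, add_tmul, hx, hy]
    | tmul y z => simp [smul_tmul']

theorem map_counitLeft_comulSecond (w : A ⊗[k] (A ⊗[k] A)) :
    Algebra.TensorProduct.map (AlgHom.id k A) (Q.counitLeft (A ⊗[k] A)) (Q.comulSecond w) = w := by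
  induction w with
  | zero => simp
  | add x y hx hy => simp only [map_add, hx, hy]
  | tmul x w => simp [comulSecond_tmul, counitLeft_comulLeft]

theorem map_counitLeft_appendOne (w : A ⊗[k] (A ⊗[k] A)) :
    Algebra.TensorProduct.map (AlgHom.id k A) (Q.counitLeft (A ⊗[k] A)) (appendOne k A w) =
      Algebra.TensorProduct.map (AlgHom.id k A)
        (Algebra.TensorProduct.includeLeft : A →ₐ[k] A ⊗[k] A)
        (Algebra.TensorProduct.map (AlgHom.id k A) (Q.counitLeft A) w) := by
  induction w using threefold_induction with
  | add x y hx hy => simp only [map_add, hx, hy]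
  | tmul x y z => simp

/-- `(ε ⊗ id ⊗ id)(Φ) = 1`. -/
theorem counitLeft_Φ : Q.counitLeft (A ⊗[k] A) Q.Φ = 1 := by
  have h := congrArg (Algebra.TensorProduct.map (AlgHom.id k A) (Q.counitLeft (A ⊗[k] A)))
    Q.pentagon'
  rw [map_mul, map_mul, map_mul, map_counitLeft_comulThird, map_counitLeft_comulLeft,
    map_counitLeft_comulSecond, map_counitLeft_appendOne, map_counitLeft_Φ, map_one, map_one,
    one_mul, mul_one] at h
  replace h := Q.Φ.isUnit.mul_right_cancel ((one_mul _).trans h)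
  simpa using (congrArg (Q.counitLeft (A ⊗[k] A)) h).symm

theorem map_Φ_inv_eq_one {B : Type*} [Ring B] [Algebra k B] (f : A ⊗[k] (A ⊗[k] A) →ₐ[k] B)
    (hf : f Q.Φ = 1) : f ↑Q.Φ⁻¹ = 1 := by
  have h : f (Q.Φ * ↑Q.Φ⁻¹) = f Q.Φ * f ↑Q.Φ⁻¹ := map_mul f _ _
  rwa [Units.mul_inv, map_one, hf, one_mul, eq_comm] at h

theorem prependOne_Φ_inv_mul_comulThird :
    prependOne k A ↑Q.Φ⁻¹ * Q.comulThird Q.Φ =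
      Q.comulSecond Q.Φ * appendOne k A Q.Φ *
        Q.comulLeft (A ⊗[k] A) ↑Q.Φ⁻¹ := by
  let u (f : A ⊗[k] (A ⊗[k] A) →ₐ[k] A ⊗[k] (A ⊗[k] (A ⊗[k] A))) := Units.map f.toMonoidHom Q.Φ
  have h : u Q.comulThird * u (Q.comulLeft _) =
      u (prependOne k A) * u Q.comulSecond * u (appendOne k A) := Units.ext Q.pentagon'
  have hinv : (u (prependOne k A))⁻¹ * u Q.comulThird =
      u Q.comulSecond * u (appendOne k A) * (u (Q.comulLeft _))⁻¹ := by
    rw [inv_mul_eq_iff_eq_mul, ← mul_assoc, ← mul_assoc, ← h, mul_inv_cancel_right]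
  exact congrArg Units.val hinv

theorem comulThird_Φ_inv_mul_prependOne :
    Q.comulThird ↑Q.Φ⁻¹ * prependOne k A Q.Φ =
      Q.comulLeft (A ⊗[k] A) Q.Φ * appendOne k A ↑Q.Φ⁻¹ *
        Q.comulSecond ↑Q.Φ⁻¹ := by
  let u (f : A ⊗[k] (A ⊗[k] A) →ₐ[k] A ⊗[k] (A ⊗[k] (A ⊗[k] A))) := Units.map f.toMonoidHom Q.Φ
  have h : u Q.comulThird * u (Q.comulLeft _) =
      u (prependOne k A) * u Q.comulSecond * u (appendOne k A) := Units.ext Q.pentagon'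
  have hinv : (u Q.comulThird)⁻¹ * u (prependOne k A) =
      u (Q.comulLeft _) * (u (appendOne k A))⁻¹ * (u Q.comulSecond)⁻¹ := by
    rw [inv_mul_eq_iff_eq_mul, ← mul_assoc, ← mul_assoc, h]
    group
  exact congrArg Units.val hinv

end QuasiBialgebra

namespace QuasiHopfAlgebra

open QuasiBialgebra

variable {k A : Type*} [CommRing k] [Ring A] [Algebra k A] (Q : QuasiHopfAlgebra k A)

/-- `x ⊗ y ⊗ z ↦ S(x) · α · y ⊗ z`. -/
noncomputable def evFirst : A ⊗[k] (A ⊗[k] A) →ₗ[k] A ⊗[k] A :=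
  TensorProduct.map (QuasiHopf.evMap Q.S Q.α) LinearMap.id ∘ₗ
    (TensorProduct.assoc k A A A).symm.toLinearMap

/-- `x ⊗ y ⊗ z ↦ x · β · S(y) ⊗ z`. -/
noncomputable def coevFirst : A ⊗[k] (A ⊗[k] A) →ₗ[k] A ⊗[k] A :=
  TensorProduct.map (QuasiHopf.coevMap Q.S Q.β) LinearMap.id ∘ₗ
    (TensorProduct.assoc k A A A).symm.toLinearMap

/-- `x ⊗ y ⊗ z ⊗ t ↦ x · β · S(y) · α · z ⊗ t`. -/
noncomputable def zigFirst : A ⊗[k] (A ⊗[k] (A ⊗[k] A)) →ₗ[k] A ⊗[k] A :=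
  TensorProduct.map (LinearMap.mul' k A) LinearMap.id ∘ₗ
    (TensorProduct.assoc k A A A).symm.toLinearMap ∘ₗ
      TensorProduct.map (LinearMap.mulRight k Q.β) Q.evFirst

/-- `x ⊗ y ⊗ z ⊗ t ↦ S(x) · α · y · β · S(z) ⊗ t`. -/
noncomputable def zagFirst : A ⊗[k] (A ⊗[k] (A ⊗[k] A)) →ₗ[k] A ⊗[k] A :=
  TensorProduct.map (LinearMap.mul' k A) LinearMap.id ∘ₗ
    (TensorProduct.assoc k A A A).symm.toLinearMap ∘ₗ
      TensorProduct.map (LinearMap.mulRight k Q.α ∘ₗ Q.S) Q.coevFirst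

@[simp] theorem evFirst_tmul (x y z : A) :
    Q.evFirst (x ⊗ₜ[k] (y ⊗ₜ[k] z)) = (Q.S x * Q.α * y) ⊗ₜ[k] z := by
  simp [evFirst]

@[simp] theorem coevFirst_tmul (x y z : A) :
    Q.coevFirst (x ⊗ₜ[k] (y ⊗ₜ[k] z)) = (x * Q.β * Q.S y) ⊗ₜ[k] z := by
  simp [coevFirst]

@[simp] theorem zigFirst_tmul (x y z t : A) :
    Q.zigFirst (x ⊗ₜ[k] (y ⊗ₜ[k] (z ⊗ₜ[k] t))) =
      (x * Q.β * Q.S y * Q.α * z) ⊗ₜ[k] t := by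
  simp [zigFirst, mul_assoc]

@[simp] theorem zagFirst_tmul (x y z t : A) :
    Q.zagFirst (x ⊗ₜ[k] (y ⊗ₜ[k] (z ⊗ₜ[k] t))) =
      (Q.S x * Q.α * y * Q.β * Q.S z) ⊗ₜ[k] t := by
  simp [zagFirst, mul_assoc]

theorem omega_eq_evFirst : Q.omega = Q.evFirst ↑Q.Φ⁻¹ := rfl

theorem theta_eq_coevFirst : Q.theta = Q.coevFirst Q.Φ := rfl

theorem evFirst_comulLeft_mul (w : A ⊗[k] A) (v : A ⊗[k] (A ⊗[k] A)) :
    Q.evFirst (Q.comulLeft A w * v) = ((1 : A) ⊗ₜ[k] Q.counitLeft A w) * Q.evFirst v := by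
  induction v using threefold_induction with
  | add x y hx hy => simp only [map_add, mul_add, hx, hy]
  | tmul x y z =>
    induction w with
    | zero => simp
    | add x y hx hy => simp only [map_add, add_mul, tmul_add, hx, hy]
    | tmul a b =>
      have key (t : A ⊗[k] A) :
          Q.evFirst (Algebra.TensorProduct.assoc k k k A A A (t ⊗ₜ[k] b) *
            x ⊗ₜ[k] (y ⊗ₜ[k] z)) =
          (Q.S x * QuasiHopf.evMap Q.S Q.α t * y) ⊗ₜ[k] (b * z) := by
        induction t with
        | zero => simp
        | add x y hx hy => simp only [map_add, add_mul, mul_add, add_tmul, hx, hy]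
        | tmul p q => simp [Q.S_mul, mul_assoc]
      rw [comulLeft_tmul, key, Q.antipode_left]
      simp [mul_assoc, smul_tmul]

theorem coevFirst_mul_comulLeft (v : A ⊗[k] (A ⊗[k] A)) (w : A ⊗[k] A) :
    Q.coevFirst (v * Q.comulLeft A w) = Q.coevFirst v * ((1 : A) ⊗ₜ[k] Q.counitLeft A w) := by
  induction v using threefold_induction with
  | add x y hx hy => simp only [map_add, add_mul, hx, hy]
  | tmul x y z =>
    induction w with
    | zero => simp
    | add x y hx hy => simp only [map_add, mul_add, tmul_add, hx, hy]
    | tmul a b =>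
      have key (t : A ⊗[k] A) :
          Q.coevFirst (x ⊗ₜ[k] (y ⊗ₜ[k] z) *
            Algebra.TensorProduct.assoc k k k A A A (t ⊗ₜ[k] b)) =
          (x * QuasiHopf.coevMap Q.S Q.β t * Q.S y) ⊗ₜ[k] (z * b) := by
        induction t with
        | zero => simp
        | add x y hx hy => simp only [map_add, add_mul, mul_add, add_tmul, hx, hy]
        | tmul p q => simp [Q.S_mul, mul_assoc]
      rw [comulLeft_tmul, key, Q.antipode_right]
      simp [mul_assoc, smul_tmul]

theorem zagFirst_comulLeft_mul (w : A ⊗[k] (A ⊗[k] A)) (v : A ⊗[k] (A ⊗[k] (A ⊗[k] A))) :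
    Q.zagFirst (Q.comulLeft (A ⊗[k] A) w * v) =
      Q.zagFirst ((1 : A) ⊗ₜ[k] ((1 : A) ⊗ₜ[k] Q.counitLeft (A ⊗[k] A) w) * v) := by
  induction w using threefold_induction with
  | add x y hx hy => simp only [map_add, add_mul, tmul_add, hx, hy]
  | tmul a b c =>
    induction v using fourfold_induction with
    | add x y hx hy => simp only [map_add, mul_add, hx, hy]
    | tmul x y z r =>
      have key (t : A ⊗[k] A) :
          Q.zagFirst (Algebra.TensorProduct.assoc k k k A A (A ⊗[k] A)
            (t ⊗ₜ[k] (b ⊗ₜ[k] c)) * x ⊗ₜ[k] (y ⊗ₜ[k] (z ⊗ₜ[k] r))) =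
          (Q.S x * QuasiHopf.evMap Q.S Q.α t * y * Q.β * Q.S (b * z)) ⊗ₜ[k] (c * r) := by
        induction t with
        | zero => simp
        | add x y hx hy => simp only [map_add, add_mul, mul_add, add_tmul, hx, hy]
        | tmul p q => simp [Q.S_mul, mul_assoc]
      rw [comulLeft_tmul, key, Q.antipode_left]
      simp [mul_assoc, smul_tmul']

theorem zigFirst_mul_comulLeft (v : A ⊗[k] (A ⊗[k] (A ⊗[k] A))) (w : A ⊗[k] (A ⊗[k] A)) :
    Q.zigFirst (v * Q.comulLeft (A ⊗[k] A) w) =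
      Q.zigFirst (v * (1 : A) ⊗ₜ[k] ((1 : A) ⊗ₜ[k] Q.counitLeft (A ⊗[k] A) w)) := by
  induction w using threefold_induction with
  | add x y hx hy => simp only [map_add, mul_add, tmul_add, hx, hy]
  | tmul a b c =>
    induction v using fourfold_induction with
    | add x y hx hy => simp only [map_add, add_mul, hx, hy]
    | tmul x y z r =>
      have key (t : A ⊗[k] A) :
          Q.zigFirst (x ⊗ₜ[k] (y ⊗ₜ[k] (z ⊗ₜ[k] r)) *
            Algebra.TensorProduct.assoc k k k A A (A ⊗[k] A) (t ⊗ₜ[k] (b ⊗ₜ[k] c))) =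
          (x * QuasiHopf.coevMap Q.S Q.β t * Q.S y * Q.α * (z * b)) ⊗ₜ[k] (r * c) := by
        induction t with
        | zero => simp
        | add x y hx hy => simp only [map_add, add_mul, mul_add, add_tmul, hx, hy]
        | tmul p q => simp [Q.S_mul, mul_assoc]
      rw [comulLeft_tmul, key, Q.antipode_right]
      simp [mul_assoc, smul_tmul']

variable (k A) in
/-- `x ⊗ y ↦ x ⊗ 1 ⊗ 1 ⊗ y`. -/
noncomputable def insertOnes : A ⊗[k] A →ₐ[k] A ⊗[k] (A ⊗[k] (A ⊗[k] A)) :=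
  Algebra.TensorProduct.map (AlgHom.id k A)
    ((Algebra.TensorProduct.includeRight : A ⊗[k] A →ₐ[k] A ⊗[k] (A ⊗[k] A)).comp
      (Algebra.TensorProduct.includeRight : A →ₐ[k] A ⊗[k] A))

@[simp] theorem insertOnes_tmul (x y : A) :
    insertOnes k A (x ⊗ₜ[k] y) = x ⊗ₜ[k] (1 ⊗ₜ[k] (1 ⊗ₜ[k] y)) := by
  simp [insertOnes]

theorem zagFirst_mul_comulSecond (v : A ⊗[k] (A ⊗[k] (A ⊗[k] A))) (w : A ⊗[k] (A ⊗[k] A)) :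
    Q.zagFirst (v * Q.comulSecond w) = Q.zagFirst (v * insertOnes k A
      (Algebra.TensorProduct.map (AlgHom.id k A) (Q.counitLeft A) w)) := by
  induction w using threefold_induction with
  | add x y hx hy => simp only [map_add, mul_add, hx, hy]
  | tmul a b c =>
    induction v using fourfold_induction with
    | add x y hx hy => simp only [map_add, add_mul, hx, hy]
    | tmul x y z r =>
      have key (t : A ⊗[k] A) :
          Q.zagFirst (x ⊗ₜ[k] (y ⊗ₜ[k] (z ⊗ₜ[k] r)) *
            a ⊗ₜ[k] Algebra.TensorProduct.assoc k k k A A A (t ⊗ₜ[k] c)) =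
          (Q.S (x * a) * Q.α * y * QuasiHopf.coevMap Q.S Q.β t * Q.S z) ⊗ₜ[k] (r * c) := by
        induction t with
        | zero => simp
        | add x y hx hy => simp only [map_add, add_mul, mul_add, add_tmul, tmul_add, hx, hy]
        | tmul p q => simp [Q.S_mul, mul_assoc]
      rw [comulSecond_tmul, comulLeft_tmul, key, Q.antipode_right]
      simp [mul_assoc, smul_tmul']

theorem zigFirst_comulSecond_mul (w : A ⊗[k] (A ⊗[k] A)) (v : A ⊗[k] (A ⊗[k] (A ⊗[k] A))) :
    Q.zigFirst (Q.comulSecond w * v) = Q.zigFirst (insertOnes k A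
      (Algebra.TensorProduct.map (AlgHom.id k A) (Q.counitLeft A) w) * v) := by
  induction w using threefold_induction with
  | add x y hx hy => simp only [map_add, add_mul, hx, hy]
  | tmul a b c =>
    induction v using fourfold_induction with
    | add x y hx hy => simp only [map_add, mul_add, hx, hy]
    | tmul x y z r =>
      have key (t : A ⊗[k] A) :
          Q.zigFirst (a ⊗ₜ[k] Algebra.TensorProduct.assoc k k k A A A (t ⊗ₜ[k] c) *
            x ⊗ₜ[k] (y ⊗ₜ[k] (z ⊗ₜ[k] r))) =
          (a * x * Q.β * Q.S y * QuasiHopf.evMap Q.S Q.α t * z) ⊗ₜ[k] (c * r) := by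
        induction t with
        | zero => simp
        | add x y hx hy => simp only [map_add, add_mul, mul_add, add_tmul, tmul_add, hx, hy]
        | tmul p q => simp [Q.S_mul, mul_assoc]
      rw [comulSecond_tmul, comulLeft_tmul, key, Q.antipode_left]
      simp [mul_assoc, smul_tmul']

theorem zigFirst_appendOne (w : A ⊗[k] (A ⊗[k] A)) :
    Q.zigFirst (appendOne k A w) = QuasiHopf.zigMap Q.S Q.α Q.β w ⊗ₜ[k] 1 := by
  induction w using threefold_induction with
  | add x y hx hy => simp only [map_add, add_tmul, hx, hy]
  | tmul x y z => simp

theorem zagFirst_appendOne (w : A ⊗[k] (A ⊗[k] A)) :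
    Q.zagFirst (appendOne k A w) = QuasiHopf.zagMap Q.S Q.α Q.β w ⊗ₜ[k] 1 := by
  induction w using threefold_induction with
  | add x y hx hy => simp only [map_add, add_tmul, hx, hy]
  | tmul x y z => simp

theorem zigFirst_prependOne_Φ_inv_mul_comulThird :
    Q.zigFirst (prependOne k A ↑Q.Φ⁻¹ * Q.comulThird Q.Φ) = 1 := by
  rw [prependOne_Φ_inv_mul_comulThird, zigFirst_mul_comulLeft,
    Q.map_Φ_inv_eq_one _ Q.counitLeft_Φ, ← Algebra.TensorProduct.one_def,
    ← Algebra.TensorProduct.one_def, mul_one, zigFirst_comulSecond_mul, Q.map_counitLeft_Φ,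
    map_one, one_mul, zigFirst_appendOne, Q.zig, Algebra.TensorProduct.one_def]

theorem zagFirst_comulThird_Φ_inv_mul_prependOne :
    Q.zagFirst (Q.comulThird ↑Q.Φ⁻¹ * prependOne k A Q.Φ) = 1 := by
  rw [comulThird_Φ_inv_mul_prependOne, zagFirst_mul_comulSecond,
    Q.map_Φ_inv_eq_one _ Q.map_counitLeft_Φ, map_one, mul_one, zagFirst_comulLeft_mul,
    Q.counitLeft_Φ, ← Algebra.TensorProduct.one_def, ← Algebra.TensorProduct.one_def, one_mul,
    zagFirst_appendOne, Q.zag, Algebra.TensorProduct.one_def]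

theorem evFirst_mul_tmul (v : A ⊗[k] (A ⊗[k] A)) (x : A) (t : A ⊗[k] A) :
    Q.evFirst (v * x ⊗ₜ[k] t) = (Q.S x ⊗ₜ[k] (1 : A)) * Q.evFirst v * t := by
  induction v using threefold_induction with
  | add x y hx hy => simp only [map_add, add_mul, mul_add, hx, hy]
  | tmul a b c =>
    induction t with
    | zero => simp
    | add x y hx hy => simp only [map_add, mul_add, tmul_add, hx, hy]
    | tmul p q => simp [Q.S_mul, mul_assoc]

theorem phi_tmul_one_mul (a : A) (t : A ⊗[k] A) :
    Q.phi ((a ⊗ₜ[k] (1 : A)) * t) = (a ⊗ₜ[k] (1 : A)) * Q.phi t := by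
  induction t with
  | zero => simp
  | add x y hx hy => simp only [map_add, mul_add, hx, hy]
  | tmul x y =>
    rw [Algebra.TensorProduct.tmul_mul_tmul, phi_tmul, phi_tmul, ← mul_assoc, ← mul_assoc,
      Algebra.TensorProduct.tmul_mul_tmul, one_mul, one_mul]

theorem psi_tmul_one_mul (a : A) (t : A ⊗[k] A) :
    Q.psi ((a ⊗ₜ[k] (1 : A)) * t) = (a ⊗ₜ[k] (1 : A)) * Q.psi t := by
  induction t with
  | zero => simp
  | add x y hx hy => simp only [map_add, mul_add, hx, hy]
  | tmul x y => simp [psi, ← mul_assoc]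

theorem phi_sandwich_tmul (p z : A) (t : A ⊗[k] A) :
    Q.phi (Q.sandwich (p ⊗ₜ[k] z) t) =
      (p ⊗ₜ[k] (1 : A)) *
        Q.evFirst (↑Q.Φ⁻¹ * Q.comulRight A t) * Q.comul z := by
  induction t with
  | zero => simp
  | add x y hx hy => simp only [map_add, mul_add, add_mul, hx, hy]
  | tmul x y =>
    simp [sandwich, phi_tmul, evFirst_mul_tmul, omega_eq_evFirst, ← mul_assoc]

theorem phi_sandwich_comul (s : A ⊗[k] A) (b : A) :
    Q.phi (Q.sandwich s (Q.comul b)) = ((1 : A) ⊗ₜ[k] b) * Q.phi s := by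
  induction s with
  | zero => simp
  | add x y hx hy => simp only [map_add, mul_add, LinearMap.add_apply, hx, hy]
  | tmul p z =>
    rw [phi_sandwich_tmul, Φ_inv_mul_comulRight_comul, evFirst_comulLeft_mul, counitLeft_comul,
      phi_tmul, omega_eq_evFirst, ← mul_assoc, ← mul_assoc, ← mul_assoc,
      Algebra.TensorProduct.tmul_mul_tmul, Algebra.TensorProduct.tmul_mul_tmul]
    simp

theorem tmul_one_mul_evFirst_mul (x y : A) (v : A ⊗[k] (A ⊗[k] A)) (t : A ⊗[k] A) :
    ((x * Q.β * Q.S y) ⊗ₜ[k] (1 : A)) * Q.evFirst v * t =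
      Q.zigFirst (prependOne k A v * x ⊗ₜ[k] (y ⊗ₜ[k] t)) := by
  induction v using threefold_induction with
  | add x y hx hy => simp only [map_add, add_mul, mul_add, hx, hy]
  | tmul a b c =>
    induction t with
    | zero => simp
    | add x y hx hy => simp only [map_add, mul_add, tmul_add, hx, hy]
    | tmul p q => simp [Q.S_mul, mul_assoc]

theorem phi_coevFirst (w : A ⊗[k] (A ⊗[k] A)) :
    Q.phi (Q.coevFirst w) =
      Q.zigFirst (prependOne k A ↑Q.Φ⁻¹ * Q.comulThird w) := by
  induction w using threefold_induction with
  | add x y hx hy => simp only [map_add, mul_add, hx, hy]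
  | tmul x y z =>
    rw [coevFirst_tmul, phi_tmul, omega_eq_evFirst, tmul_one_mul_evFirst_mul, comulThird_tmul,
      comulRight_tmul]

theorem phi_theta : Q.phi Q.theta = 1 := by
  rw [theta_eq_coevFirst, phi_coevFirst, zigFirst_prependOne_Φ_inv_mul_comulThird]

theorem phi_psi (t : A ⊗[k] A) : Q.phi (Q.psi t) = t := by
  induction t with
  | zero => simp
  | add x y hx hy => simp only [map_add, hx, hy]
  | tmul a b =>
    have h : Q.psi (a ⊗ₜ[k] b) = (a ⊗ₜ[k] (1 : A)) * Q.sandwich Q.theta (Q.comul b) := by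
      simp [psi]
    rw [h, phi_tmul_one_mul, phi_sandwich_comul, phi_theta]
    simp

theorem tmul_one_mul_sandwich_coevFirst (x : A) (w : A ⊗[k] (A ⊗[k] A)) (t : A ⊗[k] A) :
    (x ⊗ₜ[k] (1 : A)) * Q.sandwich (Q.coevFirst w) t = Q.coevFirst (x ⊗ₜ[k] t * w) := by
  induction w using threefold_induction with
  | add x y hx hy => simp only [map_add, mul_add, LinearMap.add_apply, hx, hy]
  | tmul a b c =>
    induction t with
    | zero => simp
    | add x y hx hy => simp only [map_add, mul_add, add_mul, tmul_add, hx, hy]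
    | tmul p q => simp [sandwich, Q.S_mul, mul_assoc]

/-- `ψ(t)` is the contraction of `(id ⊗ Δ)(t) · Φ` along `x ⊗ y ⊗ z ↦ x · β · S(y) ⊗ z`. -/
theorem psi_apply (t : A ⊗[k] A) :
    Q.psi t = Q.coevFirst (Q.comulRight A t * Q.Φ) := by
  induction t with
  | zero => simp
  | add x y hx hy => simp only [map_add, add_mul, hx, hy]
  | tmul x y =>
    rw [comulRight_tmul, ← tmul_one_mul_sandwich_coevFirst]
    simp [psi, theta_eq_coevFirst]

theorem psi_mul_comul (t : A ⊗[k] A) (b : A) :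
    Q.psi (t * Q.comul b) = Q.psi t * ((1 : A) ⊗ₜ[k] b) := by
  rw [psi_apply, psi_apply, map_mul (Q.comulRight A), mul_assoc, comulRight_comul_mul_Φ,
    ← mul_assoc, coevFirst_mul_comulLeft, counitLeft_comul]

theorem coevFirst_tmul_mul (x y : A) (t : A ⊗[k] A) (w : A ⊗[k] (A ⊗[k] A)) :
    Q.coevFirst ((Q.S x * Q.α * y) ⊗ₜ[k] t * w) =
      Q.zagFirst (x ⊗ₜ[k] (y ⊗ₜ[k] t) * prependOne k A w) := by
  induction w using threefold_induction with
  | add x y hx hy => simp only [map_add, mul_add, hx, hy]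
  | tmul a b c =>
    induction t with
    | zero => simp
    | add x y hx hy => simp only [map_add, add_mul, tmul_add, hx, hy]
    | tmul p q => simp [Q.S_mul, mul_assoc]

theorem psi_evFirst (v : A ⊗[k] (A ⊗[k] A)) :
    Q.psi (Q.evFirst v) = Q.zagFirst (Q.comulThird v * prependOne k A Q.Φ) := by
  induction v using threefold_induction with
  | add x y hx hy => simp only [map_add, add_mul, hx, hy]
  | tmul x y z =>
    rw [evFirst_tmul, psi_apply, comulRight_tmul, coevFirst_tmul_mul, comulThird_tmul,
      comulRight_tmul]

theorem psi_omega : Q.psi Q.omega = 1 := by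
  rw [omega_eq_evFirst, psi_evFirst, zagFirst_comulThird_Φ_inv_mul_prependOne]

theorem psi_phi (t : A ⊗[k] A) : Q.psi (Q.phi t) = t := by
  induction t with
  | zero => simp
  | add x y hx hy => simp only [map_add, hx, hy]
  | tmul a b =>
    rw [phi_tmul, mul_assoc, psi_tmul_one_mul, psi_mul_comul, psi_omega]
    simp

end QuasiHopfAlgebra

/-- For a quasi-Hopf algebra, the linear maps `φ(a ⊗ b) = (a ⊗ 1) · ω · Δ(b)` and
`ψ(a ⊗ b) = Σ (a · Xᵢ · β · S(Yᵢ) · S(b₁)) ⊗ (b₂ · Zᵢ)` are mutually inverse bijections. -/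
theorem quasiHopf_phi_psi_inverse {k A : Type*} [CommRing k] [Ring A] [Algebra k A]
    (Q : QuasiHopfAlgebra k A) :
    Q.phi ∘ₗ Q.psi = LinearMap.id ∧ Q.psi ∘ₗ Q.phi = LinearMap.id ∧
      Function.Bijective Q.phi ∧ Function.Bijective Q.psi := by
  refine ⟨LinearMap.ext Q.phi_psi, LinearMap.ext Q.psi_phi, ?_, ?_⟩
  · exact Function.bijective_iff_has_inverse.mpr ⟨Q.psi, Q.psi_phi, Q.phi_psi⟩
  · exact Function.bijective_iff_has_inverse.mpr ⟨Q.phi, Q.phi_psi, Q.psi_phi⟩
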